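/- Let M, a be reals with 0 < a < M, and let α, β, c₁, c₂ be real constants. Let R, Φ : (r₊, ∞) → ℝ be differentiable functions with R′(r) = (r²+a²)/Δ and Φ′(r) = a/Δ, and define on U: f₁ = α exp( c₁(t − R(r)) − (a c₁ + c₂/a)(φ − Φ(r)) ) and f₂ = β exp( −c₁(t + R(r)) + (a c₁ + c₂/a)(φ + Φ(r)) ). Then the 2-form F₉ = f₁ ( −(a/Δ) dt ∧ dr + dt ∧ dφ − ((r²+a²)/Δ) dr ∧ dφ ) + f₂ ( (a/Δ) dt ∧ dr + dt ∧ dφ + ((r²+a²)/Δ) dr ∧ dφ ) is closed on U and force-free: F₉_{μν} j^ν = 0 on U for all μ, where j is the current density of F₉. -/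

import Mathlib

noncomputable section

/-- Partial derivative of `f` in the coordinate direction `μ`,
coordinates `(x 0, x 1, x 2, x 3) = (t, r, θ, φ)`. -/
def pd (μ : Fin 4) (f : (Fin 4 → ℝ) → ℝ) (x : Fin 4 → ℝ) : ℝ :=
  fderiv ℝ f x (Pi.single μ 1)

/-- ρ² = r² + a² cos²θ. -/
def rho2 (a : ℝ) (x : Fin 4 → ℝ) : ℝ := (x 1) ^ 2 + a ^ 2 * Real.cos (x 2) ^ 2

/-- Δ = r² − 2Mr + a². -/
def Del (M a : ℝ) (x : Fin 4 → ℝ) : ℝ := (x 1) ^ 2 - 2 * M * (x 1) + a ^ 2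

/-- Σ² = (r²+a²)² − Δ a² sin²θ. -/
def Sig2 (M a : ℝ) (x : Fin 4 → ℝ) : ℝ :=
  ((x 1) ^ 2 + a ^ 2) ^ 2 - Del M a x * a ^ 2 * Real.sin (x 2) ^ 2

/-- The Kerr metric in Boyer–Lindquist coordinates `(t, r, θ, φ)`. -/
def kerr (M a : ℝ) (x : Fin 4 → ℝ) : Matrix (Fin 4) (Fin 4) ℝ :=
  Matrix.of fun μ ν =>
    if μ = 0 ∧ ν = 0 then -1 + 2 * M * (x 1) / rho2 a x
    else if (μ = 0 ∧ ν = 3) ∨ (μ = 3 ∧ ν = 0) then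
      -(2 * M * (x 1) * a * Real.sin (x 2) ^ 2) / rho2 a x
    else if μ = 1 ∧ ν = 1 then rho2 a x / Del M a x
    else if μ = 2 ∧ ν = 2 then rho2 a x
    else if μ = 3 ∧ ν = 3 then Sig2 M a x * Real.sin (x 2) ^ 2 / rho2 a x
    else 0

/-- The exterior Kerr domain U = {r > r₊, 0 < θ < π}. -/
def KerrExt (M a : ℝ) : Set (Fin 4 → ℝ) :=
  {x | M + Real.sqrt (M ^ 2 - a ^ 2) < x 1 ∧ 0 < x 2 ∧ x 2 < Real.pi}

/-- `wedge μ ν f` is the antisymmetric matrix of the 2-form `f dx^μ ∧ dx^ν`. -/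
def wedge (μ ν : Fin 4) (f : ℝ) : Matrix (Fin 4) (Fin 4) ℝ :=
  Matrix.of fun i j => if i = μ ∧ j = ν then f else if i = ν ∧ j = μ then -f else 0

/-- A 2-form `F` is closed on `S`: ∂_μ F_{νλ} + ∂_ν F_{λμ} + ∂_λ F_{μν} = 0. -/
def Closed2Form (F : (Fin 4 → ℝ) → Matrix (Fin 4) (Fin 4) ℝ) (S : Set (Fin 4 → ℝ)) : Prop :=
  ∀ x ∈ S, ∀ μ ν lam : Fin 4,
    pd μ (fun y => F y ν lam) x + pd ν (fun y => F y lam μ) x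
      + pd lam (fun y => F y μ ν) x = 0

/-- Current density j^μ = (ρ²sinθ)⁻¹ ∂_ν (ρ²sinθ g^{μα} g^{νβ} F_{αβ}). -/
def current (M a : ℝ) (F : (Fin 4 → ℝ) → Matrix (Fin 4) (Fin 4) ℝ)
    (x : Fin 4 → ℝ) (μ : Fin 4) : ℝ :=
  (rho2 a x * Real.sin (x 2))⁻¹ *
    ∑ ν : Fin 4, pd ν (fun y => rho2 a y * Real.sin (y 2) *
      ∑ i : Fin 4, ∑ j : Fin 4, (kerr M a y)⁻¹ μ i * (kerr M a y)⁻¹ ν j * F y i j) x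

/-- `F` is force-free on `S`: F_{μν} j^ν = 0 for the current density `j` of `F`. -/
def ForceFree (M a : ℝ) (F : (Fin 4 → ℝ) → Matrix (Fin 4) (Fin 4) ℝ)
    (S : Set (Fin 4 → ℝ)) : Prop :=
  ∀ x ∈ S, ∀ μ : Fin 4, ∑ ν : Fin 4, F x μ ν * current M a F x ν = 0

/-- f₁ = α exp( c₁(t − R(r)) − (a c₁ + c₂/a)(φ − Φ(r)) ). -/
def f1K (a α c₁ c₂ : ℝ) (R Φ : ℝ → ℝ) (x : Fin 4 → ℝ) : ℝ :=
  α * Real.exp (c₁ * (x 0 - R (x 1)) - (a * c₁ + c₂ / a) * (x 3 - Φ (x 1)))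

/-- f₂ = β exp( −c₁(t + R(r)) + (a c₁ + c₂/a)(φ + Φ(r)) ). -/
def f2K (a β c₁ c₂ : ℝ) (R Φ : ℝ → ℝ) (x : Fin 4 → ℝ) : ℝ :=
  β * Real.exp (-c₁ * (x 0 + R (x 1)) + (a * c₁ + c₂ / a) * (x 3 + Φ (x 1)))

/-- F₉ = f₁(−(a/Δ) dt∧dr + dt∧dφ − ((r²+a²)/Δ) dr∧dφ)
       + f₂((a/Δ) dt∧dr + dt∧dφ + ((r²+a²)/Δ) dr∧dφ). -/
def F9 (M a α β c₁ c₂ : ℝ) (R Φ : ℝ → ℝ) (x : Fin 4 → ℝ) : Matrix (Fin 4) (Fin 4) ℝ :=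
  f1K a α c₁ c₂ R Φ x •
      (wedge 0 1 (-(a / Del M a x)) + wedge 0 3 1
        + wedge 1 3 (-(((x 1) ^ 2 + a ^ 2) / Del M a x)))
    + f2K a β c₁ c₂ R Φ x •
      (wedge 0 1 (a / Del M a x) + wedge 0 3 1
        + wedge 1 3 (((x 1) ^ 2 + a ^ 2) / Del M a x))

theorem hx_del {M a : ℝ} (ha : 0 < a) (haM : a < M) {x : Fin 4 → ℝ} (hx : x ∈ KerrExt M a) :
    0 < Del M a x := by
  have h := hx.1
  have h0 : 0 ≤ M ^ 2 - a ^ 2 := by nlinarith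
  have h1 := Real.sq_sqrt h0
  have h2 := Real.sqrt_nonneg (M ^ 2 - a ^ 2)
  unfold Del
  nlinarith

theorem hx_sin {M a : ℝ} {x : Fin 4 → ℝ} (hx : x ∈ KerrExt M a) : 0 < Real.sin (x 2) :=
  Real.sin_pos_of_pos_of_lt_pi hx.2.1 hx.2.2

theorem hx_r {M a : ℝ} (ha : 0 < a) (haM : a < M) {x : Fin 4 → ℝ} (hx : x ∈ KerrExt M a) :
    0 < x 1 := by
  have h := hx.1
  have h2 := Real.sqrt_nonneg (M ^ 2 - a ^ 2)
  linarith

theorem hx_rho {M a : ℝ} (ha : 0 < a) (haM : a < M) {x : Fin 4 → ℝ} (hx : x ∈ KerrExt M a) :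
    0 < rho2 a x := by
  have := hx_r ha haM hx
  unfold rho2
  positivity

theorem isOpen_ext (M a : ℝ) : IsOpen (KerrExt M a) := by
  unfold KerrExt
  refine (isOpen_lt continuous_const (continuous_apply 1)).inter
    ((isOpen_lt continuous_const (continuous_apply 2)).inter
      (isOpen_lt (continuous_apply 2) continuous_const))

/-- The explicit inverse metric. -/
def kinv (M a : ℝ) (x : Fin 4 → ℝ) : Matrix (Fin 4) (Fin 4) ℝ :=
  !![-(Sig2 M a x) / (rho2 a x * Del M a x), 0, 0, -(2 * M * x 1 * a) / (rho2 a x * Del M a x);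
     0, Del M a x / rho2 a x, 0, 0;
     0, 0, 1 / rho2 a x, 0;
     -(2 * M * x 1 * a) / (rho2 a x * Del M a x), 0, 0,
      (Del M a x - a ^ 2 * Real.sin (x 2) ^ 2) / (rho2 a x * Del M a x * Real.sin (x 2) ^ 2)]

theorem kerr_inv {M a : ℝ} (ha : 0 < a) (haM : a < M) {x : Fin 4 → ℝ} (hx : x ∈ KerrExt M a) :
    (kerr M a x)⁻¹ = kinv M a x := by
  have h1 := (hx_del ha haM hx).ne'
  have h2 := (hx_sin hx).ne'
  have h3 := (hx_rho ha haM hx).ne'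
  have e1 : Del M a x = (x 1) ^ 2 - 2 * M * (x 1) + a ^ 2 := rfl
  have e3 : rho2 a x = (x 1) ^ 2 + a ^ 2 - a ^ 2 * Real.sin (x 2) ^ 2 := by
    unfold rho2; rw [Real.cos_sq']; ring
  have e4 : Sig2 M a x = ((x 1) ^ 2 + a ^ 2) ^ 2 - Del M a x * a ^ 2 * Real.sin (x 2) ^ 2 := rfl
  apply Matrix.inv_eq_right_inv
  ext i j
  fin_cases i <;> fin_cases j <;>
    simp [kerr, kinv, Matrix.mul_apply, Fin.sum_univ_four, h1, h3] <;>
    (try field_simp) <;> (try simp only [e4, e3, e1]) <;> first | (right; ring1) | ring1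

def Bf (a α β c₁ c₂ : ℝ) (R Φ : ℝ → ℝ) (x : Fin 4 → ℝ) : ℝ :=
  f1K a α c₁ c₂ R Φ x + f2K a β c₁ c₂ R Φ x
def Df (a α β c₁ c₂ : ℝ) (R Φ : ℝ → ℝ) (x : Fin 4 → ℝ) : ℝ :=
  f2K a β c₁ c₂ R Φ x - f1K a α c₁ c₂ R Φ x

theorem F9_eq (M a α β c₁ c₂ : ℝ) (R Φ : ℝ → ℝ) (x : Fin 4 → ℝ) :
    F9 M a α β c₁ c₂ R Φ x =
    !![0, a / Del M a x * Df a α β c₁ c₂ R Φ x, 0, Bf a α β c₁ c₂ R Φ x;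
       -(a / Del M a x * Df a α β c₁ c₂ R Φ x), 0, 0,
         ((x 1) ^ 2 + a ^ 2) / Del M a x * Df a α β c₁ c₂ R Φ x;
       0, 0, 0, 0;
       -Bf a α β c₁ c₂ R Φ x, -(((x 1) ^ 2 + a ^ 2) / Del M a x * Df a α β c₁ c₂ R Φ x), 0, 0] := by
  ext i j
  fin_cases i <;> fin_cases j <;> simp [F9, wedge, Bf, Df] <;> ring

/-- The raised density. -/
def Gup (M a α β c₁ c₂ : ℝ) (R Φ : ℝ → ℝ) (x : Fin 4 → ℝ) : Matrix (Fin 4) (Fin 4) ℝ :=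
    !![0, -((a * Real.sin (x 2)) * Df a α β c₁ c₂ R Φ x), 0,
          -((rho2 a x / (Del M a x * Real.sin (x 2))) * Bf a α β c₁ c₂ R Φ x);
       (a * Real.sin (x 2)) * Df a α β c₁ c₂ R Φ x, 0, 0,
          (1 / Real.sin (x 2)) * Df a α β c₁ c₂ R Φ x;
       0, 0, 0, 0;
       (rho2 a x / (Del M a x * Real.sin (x 2))) * Bf a α β c₁ c₂ R Φ x,
          -((1 / Real.sin (x 2)) * Df a α β c₁ c₂ R Φ x), 0, 0]

theorem raise {M a : ℝ} (α β c₁ c₂ : ℝ) (R Φ : ℝ → ℝ) (ha : 0 < a) (haM : a < M)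
    {x : Fin 4 → ℝ} (hx : x ∈ KerrExt M a) (μ ν : Fin 4) :
    rho2 a x * Real.sin (x 2) *
      ∑ i : Fin 4, ∑ j : Fin 4, (kerr M a x)⁻¹ μ i * (kerr M a x)⁻¹ ν j *
        F9 M a α β c₁ c₂ R Φ x i j = Gup M a α β c₁ c₂ R Φ x μ ν := by
  have h1 := (hx_del ha haM hx).ne'
  have h2 := (hx_sin hx).ne'
  have h3 := (hx_rho ha haM hx).ne'
  have e1 : Del M a x = (x 1) ^ 2 - 2 * M * (x 1) + a ^ 2 := rfl
  have e3 : rho2 a x = (x 1) ^ 2 + a ^ 2 - a ^ 2 * Real.sin (x 2) ^ 2 := by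
    unfold rho2; rw [Real.cos_sq']; ring
  have e4 : Sig2 M a x = ((x 1) ^ 2 + a ^ 2) ^ 2 - Del M a x * a ^ 2 * Real.sin (x 2) ^ 2 := rfl
  rw [kerr_inv ha haM hx, F9_eq]
  fin_cases μ <;> fin_cases ν <;>
    simp [Gup, kinv, Fin.sum_univ_four] <;>
    (try field_simp) <;> (try simp only [e4, e3, e1]) <;> first | (right; ring1) | ring1

theorem pd_neg' (μ : Fin 4) (f : (Fin 4 → ℝ) → ℝ) (x : Fin 4 → ℝ) :
    pd μ (fun y => -f y) x = -pd μ f x := by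
  unfold pd; rw [fderiv_fun_neg]; rfl

theorem pd_zero' (μ : Fin 4) (x : Fin 4 → ℝ) : pd μ (fun _ => (0:ℝ)) x = 0 := by
  simp [pd]

theorem pd_mul' (μ : Fin 4) {f g : (Fin 4 → ℝ) → ℝ} {x : Fin 4 → ℝ}
    (hf : DifferentiableAt ℝ f x) (hg : DifferentiableAt ℝ g x) (h : pd μ f x = 0) :
    pd μ (fun y => f y * g y) x = f x * pd μ g x := by
  unfold pd at *; rw [fderiv_fun_mul hf hg]; simp [h]

theorem pd_coord (μ i : Fin 4) {x : Fin 4 → ℝ} (u : ℝ → ℝ) (hu : DifferentiableAt ℝ u (x i))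
    (h : i ≠ μ) : pd μ (fun y => u (y i)) x = 0 := by
  have h1 : HasFDerivAt (fun y : Fin 4 → ℝ => y i)
    (ContinuousLinearMap.proj (R := ℝ) (φ := fun _ : Fin 4 => ℝ) i) x := hasFDerivAt_apply i x
  have := (hu.hasDerivAt.comp_hasFDerivAt x h1).fderiv
  unfold pd
  change fderiv ℝ (u ∘ fun y : Fin 4 → ℝ => y i) x _ = 0
  rw [this]
  simp [h]

/-- linear functional -/
def Lin (p q s : ℝ) : (Fin 4 → ℝ) →L[ℝ] ℝ :=
  p • ContinuousLinearMap.proj (R := ℝ) (φ := fun _ : Fin 4 => ℝ) 0 +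
  q • ContinuousLinearMap.proj (R := ℝ) (φ := fun _ : Fin 4 => ℝ) 1 +
  s • ContinuousLinearMap.proj (R := ℝ) (φ := fun _ : Fin 4 => ℝ) 3


def mm (M a c₁ c₂ : ℝ) (x : Fin 4 → ℝ) : ℝ :=
  (-c₁ * ((x 1) ^ 2 + a ^ 2) + (a * c₁ + c₂ / a) * a) / Del M a x

theorem f1_der (M a α c₁ c₂ : ℝ) (R Φ : ℝ → ℝ)
    (hR : ∀ r : ℝ, M + Real.sqrt (M ^ 2 - a ^ 2) < r →
      HasDerivAt R ((r ^ 2 + a ^ 2) / (r ^ 2 - 2 * M * r + a ^ 2)) r)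
    (hΦ : ∀ r : ℝ, M + Real.sqrt (M ^ 2 - a ^ 2) < r →
      HasDerivAt Φ (a / (r ^ 2 - 2 * M * r + a ^ 2)) r)
    {x : Fin 4 → ℝ} (hx : x ∈ KerrExt M a) : HasFDerivAt (f1K a α c₁ c₂ R Φ)
    (f1K a α c₁ c₂ R Φ x • Lin c₁ (mm M a c₁ c₂ x) (-(a * c₁ + c₂ / a))) x := by
  have hp (i : Fin 4) : HasFDerivAt (fun y : Fin 4 → ℝ => y i)
    (ContinuousLinearMap.proj (R := ℝ) (φ := fun _ : Fin 4 => ℝ) i) x := hasFDerivAt_apply i x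
  have h1 := (hR _ hx.1).comp_hasFDerivAt x (hp 1)
  have h2 := (hΦ _ hx.1).comp_hasFDerivAt x (hp 1)
  have := (((((hp 0).sub h1).const_mul c₁).sub
    (((hp 3).sub h2).const_mul (a * c₁ + c₂ / a))).exp).const_mul α
  refine this.congr_fderiv ?_
  ext v
  simp [Lin, f1K, mm, Del]
  ring

theorem f2_der (M a β c₁ c₂ : ℝ) (R Φ : ℝ → ℝ)
    (hR : ∀ r : ℝ, M + Real.sqrt (M ^ 2 - a ^ 2) < r →
      HasDerivAt R ((r ^ 2 + a ^ 2) / (r ^ 2 - 2 * M * r + a ^ 2)) r)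
    (hΦ : ∀ r : ℝ, M + Real.sqrt (M ^ 2 - a ^ 2) < r →
      HasDerivAt Φ (a / (r ^ 2 - 2 * M * r + a ^ 2)) r)
    {x : Fin 4 → ℝ} (hx : x ∈ KerrExt M a) : HasFDerivAt (f2K a β c₁ c₂ R Φ)
    (f2K a β c₁ c₂ R Φ x • Lin (-c₁) (mm M a c₁ c₂ x) (a * c₁ + c₂ / a)) x := by
  have hp (i : Fin 4) : HasFDerivAt (fun y : Fin 4 → ℝ => y i)
    (ContinuousLinearMap.proj (R := ℝ) (φ := fun _ : Fin 4 => ℝ) i) x := hasFDerivAt_apply i x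
  have h1 := (hR _ hx.1).comp_hasFDerivAt x (hp 1)
  have h2 := (hΦ _ hx.1).comp_hasFDerivAt x (hp 1)
  have := (((((hp 0).add h1).const_mul (-c₁)).add
    (((hp 3).add h2).const_mul (a * c₁ + c₂ / a))).exp).const_mul β
  refine this.congr_fderiv ?_
  ext v
  simp [Lin, f2K, mm, Del]
  ring

/-- F₉ is closed and force-free on U. -/
theorem kerr_F9_forcefree (M a α β c₁ c₂ : ℝ) (ha : 0 < a) (haM : a < M)
    (R Φ : ℝ → ℝ)
    (hR : ∀ r : ℝ, M + Real.sqrt (M ^ 2 - a ^ 2) < r →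
      HasDerivAt R ((r ^ 2 + a ^ 2) / (r ^ 2 - 2 * M * r + a ^ 2)) r)
    (hΦ : ∀ r : ℝ, M + Real.sqrt (M ^ 2 - a ^ 2) < r →
      HasDerivAt Φ (a / (r ^ 2 - 2 * M * r + a ^ 2)) r) :
    Closed2Form (F9 M a α β c₁ c₂ R Φ) (KerrExt M a) ∧
    ForceFree M a (F9 M a α β c₁ c₂ R Φ) (KerrExt M a) := by
  unfold Closed2Form ForceFree
  simp only [← forall_and]
  intro x hx
  have h1 := (hx_del ha haM hx).ne'
  have h2 := (hx_sin hx).ne'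
  have h3 := (hx_rho ha haM hx).ne'
  have e1 : Del M a x = (x 1) ^ 2 - 2 * M * (x 1) + a ^ 2 := rfl
  have e3 : rho2 a x = (x 1) ^ 2 + a ^ 2 - a ^ 2 * Real.sin (x 2) ^ 2 := by
    unfold rho2; rw [Real.cos_sq']; ring
  have d1 := f1_der M a α c₁ c₂ R Φ hR hΦ hx
  have d2 := f2_der M a β c₁ c₂ R Φ hR hΦ hx
  have dB : HasFDerivAt (Bf a α β c₁ c₂ R Φ) _ x := d1.add d2
  have dD : HasFDerivAt (Df a α β c₁ c₂ R Φ) _ x := d2.sub d1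
  set k := a * c₁ + c₂ / a with hk
  have B0 : pd 0 (Bf a α β c₁ c₂ R Φ) x = -c₁ * Df a α β c₁ c₂ R Φ x := by
    unfold pd; rw [dB.fderiv]; simp [Lin, Df]; ring
  have B1 : pd 1 (Bf a α β c₁ c₂ R Φ) x = mm M a c₁ c₂ x * Bf a α β c₁ c₂ R Φ x := by
    unfold pd; rw [dB.fderiv]; simp [Lin, Bf]; ring
  have B2 : pd 2 (Bf a α β c₁ c₂ R Φ) x = 0 := by
    unfold pd; rw [dB.fderiv]; simp [Lin]
  have B3 : pd 3 (Bf a α β c₁ c₂ R Φ) x = k * Df a α β c₁ c₂ R Φ x := by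
    unfold pd; rw [dB.fderiv]; simp [Lin, Df]; ring
  have D0 : pd 0 (Df a α β c₁ c₂ R Φ) x = -c₁ * Bf a α β c₁ c₂ R Φ x := by
    unfold pd; rw [dD.fderiv]; simp [Lin, Bf]; ring
  have D1 : pd 1 (Df a α β c₁ c₂ R Φ) x = mm M a c₁ c₂ x * Df a α β c₁ c₂ R Φ x := by
    unfold pd; rw [dD.fderiv]; simp [Lin, Df]; ring
  have D2 : pd 2 (Df a α β c₁ c₂ R Φ) x = 0 := by
    unfold pd; rw [dD.fderiv]; simp [Lin]
  have D3 : pd 3 (Df a α β c₁ c₂ R Φ) x = k * Bf a α β c₁ c₂ R Φ x := by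
    unfold pd; rw [dD.fderiv]; simp [Lin, Bf]; ring
  have hm : mm M a c₁ c₂ x = (-c₁ * ((x 1) ^ 2 + a ^ 2) + k * a) / Del M a x := rfl
  have hBd := dB.differentiableAt
  have hDd := dD.differentiableAt
  have q1 : DifferentiableAt ℝ (fun r : ℝ => a / (r ^ 2 - 2 * M * r + a ^ 2)) (x 1) := by
    rw [e1] at h1
    fun_prop (disch := assumption)
  have q2 : DifferentiableAt ℝ (fun r : ℝ => (r ^ 2 + a ^ 2) / (r ^ 2 - 2 * M * r + a ^ 2)) (x 1) := by
    rw [e1] at h1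
    fun_prop (disch := assumption)
  have pA (μ : Fin 4) (h : 1 ≠ μ) :
      pd μ (fun y => a / Del M a y * Df a α β c₁ c₂ R Φ y) x =
        a / Del M a x * pd μ (Df a α β c₁ c₂ R Φ) x :=
    pd_mul' μ (DifferentiableAt.comp x (f := fun y : Fin 4 → ℝ => y 1) q1
      (differentiableAt_apply 1 x)) hDd (pd_coord μ 1 _ q1 h)
  have pC (μ : Fin 4) (h : 1 ≠ μ) :
      pd μ (fun y => ((y 1) ^ 2 + a ^ 2) / Del M a y * Df a α β c₁ c₂ R Φ y) x =
        ((x 1) ^ 2 + a ^ 2) / Del M a x * pd μ (Df a α β c₁ c₂ R Φ) x :=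
    pd_mul' μ (DifferentiableAt.comp x (f := fun y : Fin 4 → ℝ => y 1) q2
      (differentiableAt_apply 1 x)) hDd (pd_coord μ 1 _ q2 h)
  have q3 : DifferentiableAt ℝ (fun r : ℝ => a * Real.sin r) (x 2) := by fun_prop
  have q4 : DifferentiableAt ℝ (fun r : ℝ => 1 / Real.sin r) (x 2) := by
    fun_prop (disch := assumption)
  have pS (μ : Fin 4) (h : 2 ≠ μ) :
      pd μ (fun y => a * Real.sin (y 2) * Df a α β c₁ c₂ R Φ y) x =
        a * Real.sin (x 2) * pd μ (Df a α β c₁ c₂ R Φ) x :=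
    pd_mul' μ (DifferentiableAt.comp x (f := fun y : Fin 4 → ℝ => y 2) q3
      (differentiableAt_apply 2 x)) hDd (pd_coord μ 2 _ q3 h)
  have pI (μ : Fin 4) (h : 2 ≠ μ) :
      pd μ (fun y => 1 / Real.sin (y 2) * Df a α β c₁ c₂ R Φ y) x =
        1 / Real.sin (x 2) * pd μ (Df a α β c₁ c₂ R Φ) x :=
    pd_mul' μ (DifferentiableAt.comp x (f := fun y : Fin 4 → ℝ => y 2) q4
      (differentiableAt_apply 2 x)) hDd (pd_coord μ 2 _ q4 h)
  -- the coefficient depending on both r and θ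
  have pW (μ : Fin 4) (h : 1 ≠ μ) (h' : 2 ≠ μ) :
      pd μ (fun y => rho2 a y / (Del M a y * Real.sin (y 2)) * Bf a α β c₁ c₂ R Φ y) x =
        rho2 a x / (Del M a x * Real.sin (x 2)) * pd μ (Bf a α β c₁ c₂ R Φ) x := by
    have h4 : Del M a x * Real.sin (x 2) ≠ 0 := mul_ne_zero h1 h2
    have hd : DifferentiableAt ℝ (fun y => rho2 a y / (Del M a y * Real.sin (y 2))) x := by
      unfold rho2 Del at *
      fun_prop (disch := assumption)
    refine pd_mul' μ hd hBd ?_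
    unfold pd
    rw [← hd.lineDeriv_eq_fderiv, lineDeriv]
    simp [rho2, Del, h, h']
  intro μ
  constructor
  · intro ν lam
    simp only [F9_eq]
    fin_cases μ <;> fin_cases ν <;> fin_cases lam <;>
      simp [pd_neg', pd_zero', pA, pC, B0, B1, B2, B3, D0, D1, D2, D3, hm] <;>
      field_simp <;> ring
  · have hj (ν : Fin 4) : current M a (F9 M a α β c₁ c₂ R Φ) x ν =
        (rho2 a x * Real.sin (x 2))⁻¹ *
          ∑ lam : Fin 4, pd lam (fun y => Gup M a α β c₁ c₂ R Φ y ν lam) x := by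
      unfold current
      congr 1
      refine Finset.sum_congr rfl fun lam _ => ?_
      unfold pd
      rw [Filter.EventuallyEq.fderiv_eq]
      filter_upwards [(isOpen_ext M a).mem_nhds hx] with y hy
      exact raise α β c₁ c₂ R Φ ha haM hy ν lam
    simp only [hj, F9_eq, Gup]
    simp only [Fin.sum_univ_four]
    simp only [one_div] at pI
    clear_value k
    fin_cases μ <;>
      simp [pd_neg', pd_zero', pS, pI, pW, B0, B1, B2, B3, D0, D1, D2, D3] <;>
      rw [hm] <;> field_simp <;> generalize Real.sin (x 2) = s at * <;>
      generalize Df a α β c₁ c₂ R Φ x = DD at * <;>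
      rw [e3] <;> ring
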